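/- Let X be a random variable on a product space Ω = ∏ₖ Ωₖ which is weakly difference bounded by (b, c, δ) with b ≥ c ≥ 0, and let μ = E[X]. Then for any ε > 0, P(|X − μ| ≥ ε) ≤ 2·exp(−ε²/(10nc²(1 + 2ε/(15nc))²)) + (2nb·δ^{1/2}/c)·exp(εb/(4nc²)) + 2n·δ^{1/2}. [Kutin's weak difference-bounded concentration inequality.] -/

import Mathlib

open MeasureTheory Real

universe u

/-- The probability that resampling the `k`-th coordinate changes `X` by more than `c`. -/
noncomputable def exceedance {n : ℕ} {Ω : Fin n → Type u} [∀ k, MeasurableSpace (Ω k)]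
    (μ : ∀ k, Measure (Ω k)) (X : (∀ k, Ω k) → ℝ) (c : ℝ) (k : Fin n) : ENNReal :=
  ∫⁻ ω, μ k {v | c < |X ω - X (Function.update ω k v)|} ∂(Measure.pi μ)

lemma exp_le_chord {u : ℝ} {x : ℝ} (hx : |x| ≤ 1) :
    exp (u * x) ≤ cosh u + x * sinh u := by
  obtain ⟨h1, h2⟩ := abs_le.1 hx
  have h := convexOn_exp.2 (Set.mem_univ u) (Set.mem_univ (-u))
    (by linarith : 0 ≤ (1 + x) / 2) (by linarith : 0 ≤ (1 - x) / 2) (by ring)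
  simp only [smul_eq_mul] at h
  rw [cosh_eq, sinh_eq]
  calc exp (u * x) = exp ((1 + x) / 2 * u + (1 - x) / 2 * -u) := by congr 1; ring
    _ ≤ _ := h
    _ = _ := by ring

lemma exp_le_chord_add {b c t v p : ℝ} (hc : 0 < c) (hcb : c ≤ b) (ht : 0 ≤ t)
    (htc : t * c ≤ 1) (hvb : |v| ≤ b) (hvp : |v| ≤ c + b * p) (hp : 0 ≤ p) :
    exp (t * v) ≤ cosh (t * c) + v * (sinh (t * c) / c) + b / c * exp (t * b) * p := by
  have hb : 0 < b := hc.trans_le hcb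
  have hsinh : 0 ≤ sinh (t * c) := sinh_nonneg_iff.2 (by positivity)
  have hexp : exp (t * c) = cosh (t * c) + sinh (t * c) := (cosh_add_sinh _).symm
  have hexp' : exp (-(t * c)) = cosh (t * c) - sinh (t * c) := (cosh_sub_sinh _).symm
  have key : (|v| - c) / c * exp (t * b) ≤ b / c * exp (t * b) * p := by
    have : (|v| - c) / c ≤ b * p / c := by gcongr; linarith
    calc (|v| - c) / c * exp (t * b) ≤ b * p / c * exp (t * b) := by gcongr
      _ = _ := by ring
  rcases le_or_gt |v| c with h | h
  · have h1 := exp_le_chord (u := t * c) (x := v / c) (by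
      rw [abs_div, abs_of_pos hc]; exact (div_le_one hc).2 h)
    have h2 : t * c * (v / c) = t * v := by field_simp
    rw [h2] at h1
    have : 0 ≤ b / c * exp (t * b) * p := by positivity
    have h3 : v / c * sinh (t * c) = v * (sinh (t * c) / c) := by ring
    linarith
  · rcases le_total 0 v with hv | hv
    · rw [abs_of_nonneg hv] at *
      have h1 : exp (t * v) - exp (t * c) ≤ t * (v - c) * exp (t * v) := by
        have := add_one_le_exp (t * c - t * v)
        have h2 : exp (t * c) = exp (t * c - t * v) * exp (t * v) := by
          rw [← exp_add]; congr 1; ring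
        rw [h2]
        nlinarith [exp_pos (t * v)]
      have h2 : t * (v - c) * exp (t * v) ≤ (v - c) / c * exp (t * b) := by
        have : t * (v - c) ≤ (v - c) / c := by
          rw [le_div_iff₀ hc]; nlinarith
        have h0 : 0 ≤ (v - c) / c := div_nonneg (by linarith) hc.le
        gcongr
      have h3 : sinh (t * c) ≤ v * (sinh (t * c) / c) := by
        have : v * (sinh (t * c) / c) = v / c * sinh (t * c) := by ring
        rw [this]
        exact le_mul_of_one_le_left hsinh ((one_le_div hc).2 h.le)
      linarith
    · rw [abs_of_nonpos hv] at *
      have h1 : exp (t * v) ≤ exp (-(t * c)) := exp_le_exp.2 (by nlinarith)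
      have h0 : 0 ≤ (-v - c) / c := div_nonneg (by linarith) hc.le
      have h2 : (-v - c) / c * sinh (t * c) ≤ (-v - c) / c * exp (t * b) := by
        gcongr
        have : exp (t * c) ≤ exp (t * b) := exp_le_exp.2 (by gcongr)
        linarith [cosh_pos (t * c)]
      have h3 : (-v - c) / c * sinh (t * c) = -(v * (sinh (t * c) / c)) - sinh (t * c) := by
        field_simp
      linarith

/-- Moment generating function bound for the difference between a conditional mean and the
mean, when resampling rarely changes the variable by more than `c`. -/
lemma integral_exp_conditional_mean_sub_le {α β : Type*} [MeasurableSpace α] [MeasurableSpace β]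
    (μ : Measure α) (ν : Measure β) [IsProbabilityMeasure μ] [IsProbabilityMeasure ν]
    {Y : α × β → ℝ} (hY : Measurable Y) {C : ℝ} (hC : ∀ q, |Y q| ≤ C)
    {b c t s : ℝ} (hc : 0 < c) (hcb : c ≤ b) (ht : 0 ≤ t) (htc : t * c ≤ 1) (hs : 0 ≤ s)
    (hb : ∀ w v y, |Y (w, y) - Y (v, y)| ≤ b)
    (hδ : ∫⁻ w, ∫⁻ y, μ {v | c < |Y (w, y) - Y (v, y)|} ∂ν ∂μ ≤ ENNReal.ofReal s) :
    Integrable (fun w => exp (t * (∫ y, Y (w, y) ∂ν - ∫ q, Y q ∂(μ.prod ν)))) μ ∧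
    ∫ w, exp (t * (∫ y, Y (w, y) ∂ν - ∫ q, Y q ∂(μ.prod ν))) ∂μ
      ≤ exp ((t * c) ^ 2 / 2) + b / c * s * exp (t * b) := by
  have hb0 : 0 < b := hc.trans_le hcb
  have hYint : Integrable Y (μ.prod ν) :=
    Integrable.of_bound hY.aestronglyMeasurable C (ae_of_all _ hC)
  have hYw : ∀ w, Integrable (fun y => Y (w, y)) ν := fun w =>
    Integrable.of_bound (hY.comp measurable_prodMk_left).aestronglyMeasurable C
      (ae_of_all _ fun y => hC _)
  set m := ∫ q, Y q ∂(μ.prod ν) with hm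
  set V : α → ℝ := fun w => ∫ y, Y (w, y) ∂ν - m with hV
  have hVmeas : Measurable V :=
    (hY.stronglyMeasurable.integral_prod_right').measurable.sub_const m
  let B : α → Set (β × α) := fun w => {r | c < |Y (w, r.1) - Y (r.2, r.1)|}
  have hBall : MeasurableSet {x : α × (β × α) | c < |Y (x.1, x.2.1) - Y (x.2.2, x.2.1)|} := by
    refine measurableSet_lt measurable_const ?_
    have h1 : Measurable fun x : α × (β × α) => Y (x.1, x.2.1) := hY.comp (by fun_prop)
    have h2 : Measurable fun x : α × (β × α) => Y (x.2.2, x.2.1) := hY.comp (by fun_prop)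
    exact (h1.sub h2).abs
  have hB : ∀ w, MeasurableSet (B w) := fun w => measurable_prodMk_left hBall
  let p : α → ℝ := fun w => (ν.prod μ).real (B w)
  have hBmeas : Measurable fun w => (ν.prod μ) (B w) := measurable_measure_prodMk_left hBall
  have hpmeas : Measurable p := hBmeas.ennreal_toReal
  have hp0 : ∀ w, 0 ≤ p w := fun w => measureReal_nonneg
  have hp1 : ∀ w, p w ≤ 1 := fun w => measureReal_le_one
  have hpint : Integrable p μ := Integrable.of_bound hpmeas.aestronglyMeasurable 1
    (ae_of_all _ fun w => by rw [norm_of_nonneg (hp0 w)]; exact hp1 w)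
  have hps : ∫ w, p w ∂μ ≤ s := by
    have h1 : ∫ w, p w ∂μ = (∫⁻ w, (ν.prod μ) (B w) ∂μ).toReal :=
      integral_toReal hBmeas.aemeasurable (ae_of_all _ fun w => measure_lt_top _ _)
    have h2 : ∫⁻ w, (ν.prod μ) (B w) ∂μ ≤ ENNReal.ofReal s := by
      refine le_trans (le_of_eq ?_) hδ
      refine lintegral_congr fun w => ?_
      rw [Measure.prod_apply (hB w)]
      rfl
    rw [h1]
    exact ENNReal.toReal_le_of_le_ofReal hs h2
  have hVrep : ∀ w, V w = ∫ r : β × α, (Y (w, r.1) - Y (r.2, r.1)) ∂(ν.prod μ) := by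
    intro w
    have h0 := integral_sub ((hYw w).comp_fst μ) hYint.swap
    simp only [Function.comp_apply, Prod.swap] at h0
    rw [h0]
    have h1 : ∫ r : β × α, Y (w, r.1) ∂(ν.prod μ) = ∫ y, Y (w, y) ∂ν := by
      rw [integral_fun_fst (fun y => Y (w, y))]; simp
    have h2 : ∫ r : β × α, Y (r.2, r.1) ∂(ν.prod μ) = m :=
      integral_prod_swap Y
    rw [h1, h2]
  have hdint : ∀ w, Integrable (fun r : β × α => |Y (w, r.1) - Y (r.2, r.1)|) (ν.prod μ) :=
    fun w => (((hYw w).comp_fst μ).sub hYint.swap).abs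
  have hVb : ∀ w, |V w| ≤ b := by
    intro w
    rw [hVrep]
    have := norm_integral_le_of_norm_le_const (μ := ν.prod μ)
      (f := fun r : β × α => Y (w, r.1) - Y (r.2, r.1)) (ae_of_all _ fun r => hb w r.2 r.1)
    simpa using this
  have hVp : ∀ w, |V w| ≤ c + b * p w := by
    intro w
    have hind : Integrable (fun r => c + (B w).indicator (fun _ => b) r) (ν.prod μ) :=
      (integrable_const c).add ((integrable_const b).indicator (hB w))
    rw [hVrep]
    refine (abs_integral_le_integral_abs).trans ((integral_mono (hdint w) hind ?_).trans ?_)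
    · intro r
      by_cases hr : r ∈ B w
      · simp only [Set.indicator_of_mem hr]
        linarith [hb w r.2 r.1]
      · simp only [Set.indicator_of_notMem hr, add_zero]
        exact not_lt.1 hr
    · rw [integral_add (integrable_const c) ((integrable_const b).indicator (hB w)),
        integral_indicator_const _ (hB w)]
      simp [p, mul_comm]
  have hVint : Integrable V μ := Integrable.of_bound hVmeas.aestronglyMeasurable b (ae_of_all _ hVb)
  have hV0 : ∫ w, V w ∂μ = 0 := by
    rw [hV, integral_sub hYint.integral_prod_left (integrable_const m), ← integral_prod _ hYint]
    simp [hm]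
  have hE : Integrable (fun w => exp (t * V w)) μ :=
    Integrable.of_bound (by fun_prop) (exp (t * b)) (ae_of_all _ fun w => by
      rw [norm_of_nonneg (exp_pos _).le]
      exact exp_le_exp.2 (mul_le_mul_of_nonneg_left ((le_abs_self _).trans (hVb w)) ht))
  refine ⟨hE, ?_⟩
  have hi1 : Integrable (fun w => cosh (t * c) + V w * (sinh (t * c) / c)) μ :=
    (integrable_const _).add (hVint.mul_const _)
  calc ∫ w, exp (t * V w) ∂μ
      ≤ ∫ w, (cosh (t * c) + V w * (sinh (t * c) / c) + b / c * exp (t * b) * p w) ∂μ :=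
        integral_mono hE (hi1.add (hpint.const_mul _)) fun w =>
          exp_le_chord_add hc hcb ht htc (hVb w) (hVp w) (hp0 w)
    _ = cosh (t * c) + b / c * exp (t * b) * ∫ w, p w ∂μ := by
        rw [integral_add hi1 (hpint.const_mul _),
          integral_add (integrable_const _) (hVint.mul_const _), integral_mul_const, hV0,
          integral_const_mul]
        simp
    _ ≤ exp ((t * c) ^ 2 / 2) + b / c * exp (t * b) * s := by
        gcongr
        exact cosh_le_exp_half_sq _
    _ = _ := by ring

lemma measurableSet_resample {n : ℕ} {Ω : Fin n → Type u} [∀ k, MeasurableSpace (Ω k)]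
    (μ : ∀ k, Measure (Ω k)) [∀ k, IsProbabilityMeasure (μ k)] {X : (∀ k, Ω k) → ℝ}
    (hX : Measurable X) (c : ℝ) (k : Fin n) :
    MeasurableSet {q : (∀ j, Ω j) × Ω k | c < |X q.1 - X (Function.update q.1 k q.2)|} :=
  measurableSet_lt measurable_const
    ((hX.comp measurable_fst).sub (hX.comp measurable_update')).abs

/-- Chernoff bound by induction on the number of coordinates: either the first coordinate has
exceedance more than `s`, and the bound is trivial, or its moment generating function is small. -/
lemma measure_sub_integral_ge_le {b c t s : ℝ} (hc : 0 < c) (hcb : c ≤ b) (ht : 0 ≤ t)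
    (htc : t * c ≤ 1) (hs : 0 ≤ s) {C : ℝ} : ∀ (n : ℕ) (Ω : Fin n → Type u)
    [∀ k, MeasurableSpace (Ω k)] (μ : ∀ k, Measure (Ω k)) [∀ k, IsProbabilityMeasure (μ k)]
    (X : (∀ k, Ω k) → ℝ) (_ : Measurable X) (_ : ∀ ω, |X ω| ≤ C)
    (_ : ∀ ω k v, |X ω - X (Function.update ω k v)| ≤ b) (ε : ℝ),
    Measure.pi μ {ω | ε ≤ X ω - ∫ ω', X ω' ∂(Measure.pi μ)} ≤
      ENNReal.ofReal (exp (-(t * ε)) * (exp ((t * c) ^ 2 / 2) + b / c * s * exp (t * b)) ^ n)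
        + (∑ k, exceedance μ X c k) / ENNReal.ofReal s
  | 0, Ω, _, μ, _, X, hX, hC, hb, ε => by
    rcases le_or_gt ε 0 with hε | hε
    · refine prob_le_one.trans (le_add_right ?_)
      rw [pow_zero, mul_one, ENNReal.one_le_ofReal]
      exact one_le_exp (by nlinarith)
    · have : {ω | ε ≤ X ω - ∫ ω', X ω' ∂(Measure.pi μ)} = ∅ := by
        ext ω
        have h : X = fun _ => X ω := funext fun ω' => by rw [Subsingleton.elim ω' ω]
        rw [h]
        simpa using hε
      rw [this]
      simp
  | n + 1, Ω, _, μ, _, X, hX, hC, hb, ε => by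
    set A := exp ((t * c) ^ 2 / 2) + b / c * s * exp (t * b) with hA
    have hb0 : 0 < b := hc.trans_le hcb
    have hA0 : 0 ≤ A := by positivity
    let ν : Measure (∀ j, Ω ((0 : Fin (n + 1)).succAbove j)) :=
      Measure.pi fun j => μ ((0 : Fin (n + 1)).succAbove j)
    let e := (MeasurableEquiv.piFinSuccAbove Ω 0).symm
    have he : MeasurePreserving e ((μ 0).prod ν) (Measure.pi μ) :=
      (measurePreserving_piFinSuccAbove μ 0).symm
    let Y : Ω 0 × (∀ j, Ω ((0 : Fin (n + 1)).succAbove j)) → ℝ := fun q => X (e q)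
    have hY : Measurable Y := hX.comp e.measurable
    have hYC : ∀ q, |Y q| ≤ C := fun q => hC _
    have hYb : ∀ w v y, |Y (w, y) - Y (v, y)| ≤ b := fun w v y => by
      have := hb (e (w, y)) 0 v
      rwa [show Function.update (e (w, y)) 0 v = e (v, y) from Fin.update_insertNth 0 w v y] at this
    have hYm : ∫ ω, X ω ∂(Measure.pi μ) = ∫ q, Y q ∂((μ 0).prod ν) :=
      (he.integral_comp e.measurableEmbedding X).symm
    have hex0 : exceedance μ X c 0
        = ∫⁻ w, ∫⁻ y, μ 0 {v | c < |Y (w, y) - Y (v, y)|} ∂ν ∂(μ 0) := by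
      have hmeas := measurable_measure_prodMk_left (ν := μ 0) (measurableSet_resample μ hX c 0)
      refine (he.lintegral_comp hmeas).symm.trans ?_
      rw [lintegral_prod _ (by exact (hmeas.comp e.measurable).aemeasurable)]
      refine lintegral_congr fun w => lintegral_congr fun y => ?_
      congr 1
      ext v
      simp only [Set.mem_ofPred_eq, Set.mem_preimage]
      rw [show Function.update (e (w, y)) 0 v = e (v, y) from Fin.update_insertNth 0 w v y]
    have hexs : ∀ j : Fin n, Measurable (fun w => exceedance
          (fun j => μ ((0 : Fin (n + 1)).succAbove j)) (fun y => Y (w, y)) c j) ∧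
        exceedance μ X c ((0 : Fin (n + 1)).succAbove j)
        = ∫⁻ w, exceedance (fun j => μ ((0 : Fin (n + 1)).succAbove j))
            (fun y => Y (w, y)) c j ∂(μ 0) := by
      intro j
      have hmeas := measurable_measure_prodMk_left (ν := μ ((0 : Fin (n + 1)).succAbove j))
        (measurableSet_resample μ hX c ((0 : Fin (n + 1)).succAbove j))
      have hrw : ∀ w y, μ ((0 : Fin (n + 1)).succAbove j) (Prod.mk (e (w, y)) ⁻¹'
          {q | c < |X q.1 - X (Function.update q.1 ((0 : Fin (n + 1)).succAbove j) q.2)|}) =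
          μ ((0 : Fin (n + 1)).succAbove j)
            {v | c < |Y (w, y) - Y (w, Function.update y j v)|} := by
        intro w y
        congr 1
        ext v
        simp only [Set.mem_ofPred_eq, Set.mem_preimage]
        rw [show Function.update (e (w, y)) _ v = e (w, Function.update y j v) from
          (Fin.insertNth_update 0 w j v y).symm]
      have hcomp := hmeas.comp e.measurable
      constructor
      · have := hcomp.lintegral_prod_right' (ν := ν)
        simp only [Function.comp_def, hrw] at this
        exact this
      · refine (he.lintegral_comp hmeas).symm.trans ?_
        rw [lintegral_prod _ (by exact hcomp.aemeasurable)]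
        simp only [hrw]
        rfl
    rw [Fin.sum_univ_succAbove _ 0]
    rcases lt_or_ge (ENNReal.ofReal s) (exceedance μ X c 0) with hlt | hle
    · refine prob_le_one.trans (le_add_left ?_)
      have hle := hlt.trans_le (le_self_add (b := ∑ j, exceedance μ X c (Fin.succAbove 0 j)))
      rw [ENNReal.le_div_iff_mul_le (.inr (ne_bot_of_gt hle)) (.inl ENNReal.ofReal_ne_top), one_mul]
      exact hle.le
    · rw [hex0] at hle
      obtain ⟨hint, hmgf⟩ := integral_exp_conditional_mean_sub_le (μ 0) ν hY hYC hc hcb ht htc hs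
        hYb hle
      have hset : MeasurableSet {ω | ε ≤ X ω - ∫ ω', X ω' ∂(Measure.pi μ)} :=
        measurableSet_le measurable_const (hX.sub_const _)
      rw [← he.measure_preimage hset.nullMeasurableSet,
        Measure.prod_apply (e.measurable hset)]
      set m := ∫ q, Y q ∂((μ 0).prod ν) with hm
      have hslice : ∀ w, ν (Prod.mk w ⁻¹' (e ⁻¹' {ω | ε ≤ X ω - ∫ ω', X ω' ∂(Measure.pi μ)})) ≤
          ENNReal.ofReal (exp (-(t * ε)) * A ^ n * exp (t * (∫ y, Y (w, y) ∂ν - m))) +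
          (∑ j, exceedance (fun j => μ ((0 : Fin (n + 1)).succAbove j)) (fun y => Y (w, y)) c j)
            / ENNReal.ofReal s := by
        intro w
        have ih := measure_sub_integral_ge_le hc hcb ht htc hs n _
          (fun j => μ ((0 : Fin (n + 1)).succAbove j)) (fun y => Y (w, y))
          (hY.comp measurable_prodMk_left) (fun y => hYC _) (fun y j v => by
            have := hb (e (w, y)) ((0 : Fin (n + 1)).succAbove j) v
            rwa [show Function.update (e (w, y)) _ v = e (w, Function.update y j v) from
              (Fin.insertNth_update 0 w j v y).symm] at this)
          (ε - (∫ y, Y (w, y) ∂ν - m))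
        convert ih using 2
        · ext y
          simp only [Set.mem_preimage, Set.mem_ofPred_eq, hYm]
          change ε ≤ Y (w, y) - m ↔ ε - (∫ y, Y (w, y) ∂ν - m) ≤ Y (w, y) - ∫ y, Y (w, y) ∂ν
          constructor <;> intro h <;> linarith
        · congr 1
          rw [mul_right_comm, ← exp_add]
          congr 2
          ring
      refine (lintegral_mono hslice).trans ?_
      rw [lintegral_add_left' (by
        exact (hint.aestronglyMeasurable.aemeasurable.const_mul _).ennreal_ofReal)]
      refine add_le_add ?_ ?_
      · rw [← ofReal_integral_eq_lintegral_ofReal (hint.const_mul _)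
          (ae_of_all _ fun w => by positivity), integral_const_mul]
        refine ENNReal.ofReal_le_ofReal ?_
        rw [pow_succ, ← mul_assoc]
        gcongr
      · simp only [div_eq_mul_inv]
        rw [lintegral_mul_const _ (Finset.measurable_sum _ fun j _ => (hexs j).1),
          lintegral_finsetSum _ fun j _ => (hexs j).1]
        gcongr
        simp only [← (hexs _).2]
        exact le_add_self

lemma main_exponent_le {x : ℝ} (hx : 0 < x) :
    (min (x / 4) 1) ^ 2 / 2 - min (x / 4) 1 * x ≤ -(x ^ 2 / (10 * (1 + 2 * x / 15) ^ 2)) := by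
  have hd : 0 < 10 * (1 + 2 * x / 15) ^ 2 := by positivity
  rw [le_neg, div_le_iff₀ hd]
  rcases le_total (x / 4) 1 with h | h
  · rw [min_eq_left h]
    have : 1 ≤ (1 + 2 * x / 15) ^ 2 := by nlinarith
    nlinarith [mul_nonneg (sq_nonneg x) (sub_nonneg.2 this), sq_nonneg x]
  · rw [min_eq_right h]
    have : 8 * x / 15 ≤ (1 + 2 * x / 15) ^ 2 := by nlinarith [sq_nonneg (1 - 2 * x / 15)]
    nlinarith [mul_nonneg (by linarith : 0 ≤ x - 1/2) (sub_nonneg.2 this)]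

lemma abs_sub_le_card_mul {n : ℕ} {Ω : Fin n → Type u} {X : (∀ k, Ω k) → ℝ} {b : ℝ}
    (hb : ∀ ω k v, |X ω - X (Function.update ω k v)| ≤ b) (ω ω₀ : ∀ k, Ω k) :
    |X ω - X ω₀| ≤ n * b := by
  have h : ∀ S : Finset (Fin n), |X (S.piecewise ω ω₀) - X ω₀| ≤ S.card * b := by
    intro S
    induction S using Finset.induction_on with
    | empty => simp
    | insert k S hk ih =>
      rw [Finset.piecewise_insert, Finset.card_insert_of_notMem hk]
      have h1 := hb (S.piecewise ω ω₀) k (ω k)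
      rw [abs_sub_comm] at h1
      push_cast
      calc _ ≤ _ := abs_sub_le _ (X (S.piecewise ω ω₀)) _
        _ ≤ b + S.card * b := add_le_add h1 ih
        _ = _ := by ring
  simpa using h Finset.univ

/-- One-sided tail bound, in the regime where the two-sided bound is not trivial. -/
lemma measure_sub_integral_ge_le_of_small {n : ℕ} (hn : 0 < n) {Ω : Fin n → Type u}
    [∀ k, MeasurableSpace (Ω k)] (μ : ∀ k, Measure (Ω k)) [∀ k, IsProbabilityMeasure (μ k)]
    {X : (∀ k, Ω k) → ℝ} (hX : Measurable X) {b c δ C : ℝ} (hcb : c ≤ b) (hc : 0 < c)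
    (hδ : 0 ≤ δ) (hC : ∀ ω, |X ω| ≤ C)
    (hweak : ∀ k, exceedance μ X c k ≤ ENNReal.ofReal δ)
    (hb : ∀ ω k v, |X ω - X (Function.update ω k v)| ≤ b) {ε : ℝ} (hε : 0 < ε)
    (hM : exp (-ε ^ 2 / (10 * n * c ^ 2 * (1 + 2 * ε / (15 * n * c)) ^ 2)) ≤ 1 / 2)
    (hB : n * b * √δ / c * exp (ε * b / (4 * n * c ^ 2)) ≤ 1 / 2) :
    Measure.pi μ {ω | ε ≤ X ω - ∫ ω', X ω' ∂(Measure.pi μ)} ≤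
      ENNReal.ofReal (exp (-ε ^ 2 / (10 * n * c ^ 2 * (1 + 2 * ε / (15 * n * c)) ^ 2))
        + n * b * √δ / c * exp (ε * b / (4 * n * c ^ 2)) + n * √δ) := by
  have hb0 : 0 < b := hc.trans_le hcb
  have hn0 : (0 : ℝ) < n := by exact_mod_cast hn
  set M := exp (-ε ^ 2 / (10 * n * c ^ 2 * (1 + 2 * ε / (15 * n * c)) ^ 2)) with hMdef
  set y := n * b * √δ / c * exp (ε * b / (4 * n * c ^ 2)) with hy
  have hy0 : 0 ≤ y := by positivity
  set x := ε / (n * c) with hx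
  have hx0 : 0 < x := by positivity
  set τ := min (x / 4) 1 with hτ
  have hτ0 : 0 ≤ τ := le_min (by positivity) zero_le_one
  have htc : τ / c * c = τ := by field_simp
  have key := measure_sub_integral_ge_le hc hcb (div_nonneg hτ0 hc.le)
    (by rw [htc]; exact min_le_right _ _) (sqrt_nonneg δ) n Ω μ X hX hC hb ε
  rw [htc] at key
  refine key.trans ?_
  rw [ENNReal.ofReal_add (by positivity) (by positivity)]
  refine add_le_add (ENNReal.ofReal_le_ofReal ?_) ?_
  · have hBy : n * (b / c * √δ * exp (τ / c * b)) ≤ y := by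
      have : exp (τ / c * b) ≤ exp (ε * b / (4 * n * c ^ 2)) := by
        refine exp_le_exp.2 ?_
        calc τ / c * b ≤ x / 4 / c * b := by gcongr; exact min_le_left _ _
          _ = _ := by rw [hx]; field_simp
      calc n * (b / c * √δ * exp (τ / c * b))
          ≤ n * (b / c * √δ * exp (ε * b / (4 * n * c ^ 2))) := by gcongr
        _ = y := by rw [hy]; ring
    set B := b / c * √δ * exp (τ / c * b) with hBdef
    have hB0 : 0 ≤ B := by positivity
    have hpow : (exp (τ ^ 2 / 2) + B) ^ n ≤ exp (n * (τ ^ 2 / 2)) * exp y := by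
      calc (exp (τ ^ 2 / 2) + B) ^ n ≤ (exp (τ ^ 2 / 2) * exp B) ^ n := by
            gcongr
            have h1 : 1 ≤ exp (τ ^ 2 / 2) := one_le_exp (by positivity)
            nlinarith [add_one_le_exp B]
        _ = exp (n * (τ ^ 2 / 2)) * exp (n * B) := by
            rw [mul_pow, ← exp_nat_mul, ← exp_nat_mul]
        _ ≤ _ := by gcongr
    have hmain : exp (-(τ / c * ε)) * exp (n * (τ ^ 2 / 2)) ≤ M := by
      rw [← exp_add, hMdef]
      refine exp_le_exp.2 ?_
      have h1 := mul_le_mul_of_nonneg_left (main_exponent_le hx0) hn0.le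
      have h2 : -(τ / c * ε) + n * (τ ^ 2 / 2) = n * (τ ^ 2 / 2 - τ * x) := by
        rw [hx]; field_simp; ring
      have h3 : n * -(x ^ 2 / (10 * (1 + 2 * x / 15) ^ 2))
          = -ε ^ 2 / (10 * n * c ^ 2 * (1 + 2 * ε / (15 * n * c)) ^ 2) := by
        have : 2 * ε / (15 * n * c) = 2 * x / 15 := by rw [hx]; field_simp
        rw [this]
        have h4 : ε = x * (n * c) := by rw [hx]; field_simp
        rw [h4]
        have : (1 + 2 * x / 15) ≠ 0 := by positivity
        generalize 1 + 2 * x / 15 = z at *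
        field_simp
      rw [h2, ← h3]
      exact h1
    have hexpy : exp y ≤ 1 + 2 * y := by
      have := abs_exp_sub_one_le (x := y) (by rw [abs_of_nonneg hy0]; linarith)
      rw [abs_of_nonneg hy0] at this
      linarith [(abs_le.1 this).2]
    calc exp (-(τ / c * ε)) * (exp (τ ^ 2 / 2) + B) ^ n
        ≤ exp (-(τ / c * ε)) * (exp (n * (τ ^ 2 / 2)) * exp y) := by gcongr
      _ = exp (-(τ / c * ε)) * exp (n * (τ ^ 2 / 2)) * exp y := by ring
      _ ≤ M * (1 + 2 * y) := by gcongr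
      _ ≤ M + y := by nlinarith
  · have hsum : ∑ k, exceedance μ X c k ≤ n * ENNReal.ofReal δ := by
      simpa using Finset.sum_le_sum fun k (_ : k ∈ Finset.univ) => hweak k
    refine ENNReal.div_le_of_le_mul (hsum.trans (le_of_eq ?_))
    rw [← ENNReal.ofReal_natCast, ← ENNReal.ofReal_mul hn0.le, ← ENNReal.ofReal_mul (by positivity),
      mul_assoc, mul_self_sqrt hδ]

/-- Kutin's concentration inequality for weakly difference-bounded random variables:
if `X` on a product space is weakly difference bounded by `(b, c, δ)` with `b ≥ c ≥ 0`,
then for all `ε > 0`,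
`P(|X − E X| ≥ ε) ≤ 2 exp(−ε²/(10nc²(1 + 2ε/(15nc))²)) + (2nb√δ/c)·exp(εb/(4nc²)) + 2n√δ`. -/
theorem stmt_16
    (n : ℕ) (hn : 0 < n)
    (Ωk : Fin n → Type*) [∀ k, MeasurableSpace (Ωk k)]
    (μk : ∀ k, Measure (Ωk k)) [∀ k, IsProbabilityMeasure (μk k)]
    (X : (∀ k, Ωk k) → ℝ) (hX : Measurable X)
    (hXint : Integrable X (Measure.pi μk))
    (b c δ : ℝ) (hbc : c ≤ b) (hc : 0 < c) (hδ : 0 ≤ δ)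
    (hweak : ∀ k : Fin n,
      ((Measure.pi μk).prod (μk k))
          {q : (∀ j, Ωk j) × Ωk k | c < |X q.1 - X (Function.update q.1 k q.2)|}
        ≤ ENNReal.ofReal δ)
    (hglobal : ∀ ω ω' : ∀ k, Ωk k,
      (∃ k, ∀ j, j ≠ k → ω j = ω' j) → |X ω - X ω'| ≤ b)
    (ε : ℝ) (hε : 0 < ε) :
    Measure.pi μk {ω | ε ≤ |X ω - ∫ ω', X ω' ∂(Measure.pi μk)|}
      ≤ ENNReal.ofReal
          (2 * exp (-ε ^ 2 / (10 * n * c ^ 2 * (1 + 2 * ε / (15 * n * c)) ^ 2))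
            + (2 * n * b * Real.sqrt δ / c) * exp (ε * b / (4 * n * c ^ 2))
            + 2 * n * Real.sqrt δ) := by
  have hb0 : 0 < b := hc.trans_le hbc
  have hb : ∀ ω k v, |X ω - X (Function.update ω k v)| ≤ b := fun ω k v =>
    hglobal _ _ ⟨k, fun j hj => (Function.update_of_ne hj _ _).symm⟩
  have hex : ∀ k, exceedance μk X c k ≤ ENNReal.ofReal δ := fun k => by
    have := hweak k
    rwa [Measure.prod_apply (measurableSet_resample μk hX c k)] at this
  obtain ⟨ω₀⟩ : Nonempty (∀ k, Ωk k) := ⟨fun k => (nonempty_of_isProbabilityMeasure (μk k)).some⟩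
  have hC : ∀ ω, |X ω| ≤ n * b + |X ω₀| := fun ω => by
    have h1 := abs_sub_le_card_mul hb ω ω₀
    have h2 := abs_sub_abs_le_abs_sub (X ω) (X ω₀)
    linarith
  have hP : 0 ≤ n * b * √δ / c * exp (ε * b / (4 * n * c ^ 2)) := by positivity
  have hQ : 0 ≤ n * √δ := by positivity
  have hM0 := exp_pos (-ε ^ 2 / (10 * n * c ^ 2 * (1 + 2 * ε / (15 * n * c)) ^ 2))
  have htwo : 2 * exp (-ε ^ 2 / (10 * n * c ^ 2 * (1 + 2 * ε / (15 * n * c)) ^ 2))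
      + (2 * n * b * √δ / c) * exp (ε * b / (4 * n * c ^ 2)) + 2 * n * √δ
      = (exp (-ε ^ 2 / (10 * n * c ^ 2 * (1 + 2 * ε / (15 * n * c)) ^ 2))
        + n * b * √δ / c * exp (ε * b / (4 * n * c ^ 2)) + n * √δ)
      + (exp (-ε ^ 2 / (10 * n * c ^ 2 * (1 + 2 * ε / (15 * n * c)) ^ 2))
        + n * b * √δ / c * exp (ε * b / (4 * n * c ^ 2)) + n * √δ) := by ring
  rw [htwo]
  by_cases hM : exp (-ε ^ 2 / (10 * n * c ^ 2 * (1 + 2 * ε / (15 * n * c)) ^ 2)) ≤ 1 / 2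
  swap
  · refine prob_le_one.trans (ENNReal.one_le_ofReal.2 ?_)
    linarith
  by_cases hB : n * b * √δ / c * exp (ε * b / (4 * n * c ^ 2)) ≤ 1 / 2
  swap
  · refine prob_le_one.trans (ENNReal.one_le_ofReal.2 ?_)
    linarith
  have hupper := measure_sub_integral_ge_le_of_small hn μk hX hbc hc hδ hC hex hb hε hM hB
  have habs : ∀ ω ω', |-X ω - -X ω'| = |X ω - X ω'| := fun ω ω' => by
    rw [neg_sub_neg, abs_sub_comm]
  have hlower := measure_sub_integral_ge_le_of_small (X := fun ω => -X ω) hn μk hX.neg hbc hc hδ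
    (fun ω => (abs_neg (X ω)).trans_le (hC ω))
    (by simpa only [exceedance, habs] using hex) (by simpa only [habs] using hb) hε hM hB
  rw [ENNReal.ofReal_add (by positivity) (by positivity)]
  refine le_trans (measure_mono ?_) ((measure_union_le _ _).trans (add_le_add hupper hlower))
  intro ω hω
  rcases le_abs.1 (Set.mem_ofPred_eq ▸ hω) with h | h
  · exact Or.inl h
  · refine Or.inr ?_
    simp only [Set.mem_ofPred_eq, integral_neg]
    linarith
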